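/- arXiv:2012.07573 — 2 statements merged into one kernel-verified Lean document; each statement's English description precedes it below -/
import Mathlib

section
/- Suppose (τ_n)_{n≥0} is a sequence of polynomials in R with τ_0 = 1 which satisfies, for every n ≥ 0: (i) the dimension constraint L_0 τ_n = n·τ_n, and (ii) the Virasoro constraints: for every integer k ≥ 0, (1/2) L_{2k} τ_n − (1/2) ∂_{2k+1} τ_{n+1} + (δ_{k,0}/16) τ_n = 0. Then the sequence satisfies the cut-and-join recursion (n+1) τ_{n+1} = W_0 τ_n for all n ≥ 0, where W_0 = W_0(0). (This is the coefficient-wise form, in the expansion τ = Σ_n τ_n ħ^n, of the statement that the Heisenberg–Virasoro constraints for the Brézin–Gross–Witten tau-function imply the cut-and-join equation ∂τ/∂ħ = W_0 τ, and hence τ_{BGW} = e^{ħ W_0}·1.) -/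
open MvPolynomial

/-- `R` is the polynomial ring over `ℝ` in the variables `t_k`, `k` a positive odd
integer; the variable `X n` represents `t_{2n+1}`. -/
abbrev PR : Type := MvPolynomial ℕ ℝ

/-- The BGW cut-and-join operator `W_0 = W_0(0)`:
`W_0 P = Σ_{k,m odd ≥ 1} ( k m t_k t_m ∂_{k+m-1} P + (1/2)(k+m+1) t_{k+m+1} ∂_k ∂_m P )
 + (t_1/8) P`, written in the encoding `t_{2a+1} = X a`. -/
noncomputable def W0 (P : PR) : PR :=
  (∑ᶠ (a : ℕ) (b : ℕ),
      ((((2 * a + 1) * (2 * b + 1) : ℕ) : ℝ) • (X a * X b * pderiv (a + b) P)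
        + (((2 * a + 2 * b + 3 : ℕ) : ℝ) / 2) • (X (a + b + 1) * pderiv a (pderiv b P))))
  + (1 / 8 : ℝ) • (X 0 * P)

/-- The Virasoro operator `L_{2k}` (for `k ≥ 0`) restricted to odd times:
`L_{2k} P = Σ_{a odd ≥ 1} a t_a ∂_{a+2k} P + (1/2) Σ_{a,b odd ≥ 1, a+b=2k} ∂_a ∂_b P`,
in the encoding `t_{2i+1} = X i` (so `∂_{a+2k}` becomes `∂_{i+k}` and the condition
`a + b = 2k` for `a = 2i+1`, `b = 2j+1` reads `i + j + 1 = k`). -/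
noncomputable def Lop (k : ℕ) (P : PR) : PR :=
  (∑ᶠ i : ℕ, (((2 * i + 1 : ℕ) : ℝ)) • (X i * pderiv (i + k) P))
  + (1 / 2 : ℝ) • (∑ᶠ (i : ℕ) (j : ℕ),
      if i + j + 1 = k then pderiv i (pderiv j P) else 0)

/-- A `finsum` over `ℕ` of a function vanishing from `M` on is the sum over `range M`. -/
theorem finsum_eq_sum_range {A : Type*} [AddCommMonoid A] {f : ℕ → A} {M : ℕ}
    (h : ∀ i, M ≤ i → f i = 0) : ∑ᶠ i, f i = ∑ i ∈ Finset.range M, f i := by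
  refine finsum_eq_sum_of_support_subset f fun i hi => ?_
  simp only [Finset.coe_range, Set.mem_Iio]
  by_contra! hM
  exact hi (h i hM)

theorem pderiv_comm (i j : ℕ) (P : PR) :
    pderiv i (pderiv j P) = pderiv j (pderiv i P) := by
  have h : ⁅(pderiv i : Derivation ℝ PR PR), (pderiv j : Derivation ℝ PR PR)⁆ = 0 := by
    refine MvPolynomial.derivation_ext fun k => ?_
    classical
    simp only [Derivation.commutator_apply, pderiv_X, Pi.single_apply, Derivation.zero_apply]
    split_ifs <;> simp
  have h2 := congrArg (fun D : Derivation ℝ PR PR => D P) h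
  simpa [Derivation.commutator_apply, sub_eq_zero] using h2

/-- All partial derivatives of a polynomial with large enough index vanish. -/
theorem exists_forall_pderiv_eq_zero (P : PR) : ∃ N, ∀ i, N ≤ i → pderiv i P = 0 := by
  refine ⟨P.vars.sup id + 1, fun i hi => pderiv_eq_zero_of_notMem_vars fun hmem => ?_⟩
  have : i ≤ P.vars.sup id := Finset.le_sup (f := id) hmem
  omega

theorem Lop_eq_sum {P : PR} {M : ℕ} (hP : ∀ i, M ≤ i → pderiv i P = 0) (k : ℕ) :
    Lop k P = ∑ i ∈ Finset.range M, ((2 * i + 1 : ℕ) : ℝ) • (X i * pderiv (i + k) P)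
      + (1 / 2 : ℝ) • ∑ i ∈ Finset.range M, ∑ j ∈ Finset.range M,
          if i + j + 1 = k then pderiv i (pderiv j P) else 0 := by
  have hinner (i : ℕ) : (∑ᶠ j : ℕ, if i + j + 1 = k then pderiv i (pderiv j P) else 0) =
      ∑ j ∈ Finset.range M, if i + j + 1 = k then pderiv i (pderiv j P) else 0 :=
    finsum_eq_sum_range fun j hj => by simp [hP j hj]
  unfold Lop
  simp only [hinner]
  rw [finsum_eq_sum_range (M := M) fun i hi => by simp [hP (i + k) (by omega)],
    finsum_eq_sum_range (M := M) fun i hi => by simp [pderiv_comm i, hP i hi]]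

theorem Lop_zero_eq_sum {P : PR} {M : ℕ} (hP : ∀ i, M ≤ i → pderiv i P = 0) :
    Lop 0 P = ∑ i ∈ Finset.range M, ((2 * i + 1 : ℕ) : ℝ) • (X i * pderiv i P) := by
  simp [Lop_eq_sum hP]

theorem W0_eq_sum {P : PR} {M : ℕ} (hP : ∀ i, M ≤ i → pderiv i P = 0) :
    W0 P = ∑ a ∈ Finset.range M, ∑ b ∈ Finset.range M,
      ((((2 * a + 1) * (2 * b + 1) : ℕ) : ℝ) • (X a * X b * pderiv (a + b) P)
        + (((2 * a + 2 * b + 3 : ℕ) : ℝ) / 2) • (X (a + b + 1) * pderiv a (pderiv b P)))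
      + (1 / 8 : ℝ) • (X 0 * P) := by
  have hinner (a : ℕ) := finsum_eq_sum_range (M := M) (f := fun b =>
      (((2 * a + 1) * (2 * b + 1) : ℕ) : ℝ) • (X a * X b * pderiv (a + b) P)
        + (((2 * a + 2 * b + 3 : ℕ) : ℝ) / 2) • (X (a + b + 1) * pderiv a (pderiv b P)))
    fun b hb => by simp [hP b hb, hP (a + b) (by omega)]
  unfold W0
  simp only [hinner]
  rw [finsum_eq_sum_range (M := M) fun a ha => Finset.sum_eq_zero fun b _ => by
    simp [pderiv_comm a, hP a ha, hP (a + b) (by omega)]]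

/-- Substituting the operators `L_{2k}` for `∂_{2k+1}` in the Euler operator gives the
cut-and-join operator without its linear term. -/
theorem sum_X_mul_Lop {P : PR} {N M : ℕ} (hP : ∀ i, N ≤ i → pderiv i P = 0)
    (hM : 2 * N ≤ M) :
    ∑ k ∈ Finset.range M, ((2 * k + 1 : ℕ) : ℝ) • (X k * Lop k P)
      + (1 / 8 : ℝ) • (X 0 * P) = W0 P := by
  have hPM : ∀ i, M ≤ i → pderiv i P = 0 := fun i hi => hP i (by omega)
  have hquad : ∑ k ∈ Finset.range M, ((2 * k + 1 : ℕ) : ℝ) •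
        (X k * ((1 / 2 : ℝ) • ∑ i ∈ Finset.range M, ∑ j ∈ Finset.range M,
          if i + j + 1 = k then pderiv i (pderiv j P) else 0)) =
      ∑ a ∈ Finset.range M, ∑ b ∈ Finset.range M, (((2 * a + 2 * b + 3 : ℕ) : ℝ) / 2) •
        (X (a + b + 1) * pderiv a (pderiv b P)) := by
    simp only [Finset.mul_sum, Finset.smul_sum]
    rw [Finset.sum_comm]
    refine Finset.sum_congr rfl fun a _ => ?_
    rw [Finset.sum_comm]
    refine Finset.sum_congr rfl fun b _ => ?_
    rw [Finset.sum_eq_single (a + b + 1)]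
    · rw [if_pos rfl, mul_smul_comm, smul_smul]
      congr 1
      push_cast
      ring
    · intro k _ hk
      simp [hk.symm]
    · intro hk
      have : N ≤ a ∨ N ≤ b := by
        rw [Finset.mem_range] at hk
        omega
      rcases this with h | h
      · simp [pderiv_comm a, hP a h]
      · simp [hP b h]
  rw [W0_eq_sum hPM]
  simp only [Lop_eq_sum hPM, mul_add, smul_add, Finset.sum_add_distrib]
  rw [hquad]
  congr 2
  refine Finset.sum_congr rfl fun a _ => ?_
  rw [Finset.mul_sum, Finset.smul_sum]
  refine Finset.sum_congr rfl fun b _ => ?_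
  rw [mul_smul_comm, smul_smul, add_comm b a, mul_assoc]
  congr 1
  push_cast
  ring

/-- If a sequence `(τ_n)` of polynomials with `τ_0 = 1` satisfies the dimension
constraint `L_0 τ_n = n τ_n` and the Virasoro constraints
`(1/2) L_{2k} τ_n - (1/2) ∂_{2k+1} τ_{n+1} + (δ_{k,0}/16) τ_n = 0` (for all `k ≥ 0`),
then it satisfies the cut-and-join recursion `(n+1) τ_{n+1} = W_0 τ_n`.
(Coefficient-wise form of `∂τ/∂ħ = W_0 τ`, hence `τ_BGW = e^{ħ W_0} · 1`.) -/
theorem statement6 (τ : ℕ → PR) (h0 : τ 0 = 1)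
    (hdim : ∀ n : ℕ, Lop 0 (τ n) = (n : ℝ) • τ n)
    (hvir : ∀ (n k : ℕ),
      (1 / 2 : ℝ) • Lop k (τ n) - (1 / 2 : ℝ) • pderiv k (τ (n + 1))
        + (if k = 0 then (1 / 16 : ℝ) else 0) • τ n = 0) :
    ∀ n : ℕ, ((n : ℝ) + 1) • τ (n + 1) = W0 (τ n) := by
  intro n
  have hderiv (k : ℕ) : pderiv k (τ (n + 1)) =
      Lop k (τ n) + (if k = 0 then (1 / 8 : ℝ) else 0) • τ n := by
    have h := congrArg (fun Q : PR => (2 : ℝ) • Q) (hvir n k)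
    simp only [smul_add, smul_sub, smul_smul, smul_zero, mul_ite, mul_zero] at h
    norm_num at h
    rw [← sub_eq_zero, ← neg_eq_zero, ← h]
    norm_num
    ring
  obtain ⟨N, hN⟩ := exists_forall_pderiv_eq_zero (τ n)
  obtain ⟨N', hN'⟩ := exists_forall_pderiv_eq_zero (τ (n + 1))
  have hM : ∀ i, 2 * N + N' + 1 ≤ i → pderiv i (τ (n + 1)) = 0 := fun i hi => hN' i (by omega)
  have hE := hdim (n + 1)
  rw [Lop_zero_eq_sum hM, Nat.cast_add, Nat.cast_one] at hE
  rw [← hE, ← sum_X_mul_Lop hN (M := 2 * N + N' + 1) (by omega)]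
  simp only [hderiv, mul_add, smul_add, Finset.sum_add_distrib]
  congr 1
  rw [Finset.sum_eq_single 0]
  · simp
  · intro k _ hk
    simp [hk]
  · simp
end

section
/- Let c_n = (1/n!)·W_0^n·1 for 0 ≤ n ≤ 6, where W_0^n·1 denotes the n-fold application of the BGW cut-and-join operator W_0 to the constant polynomial 1 (so c_0 = 1). Then in the ring R[ħ] the truncated series Σ_{n=0}^{6} c_n ħ^n agrees modulo ħ^7 with the exponential exp( a_1 ħ + a_2 ħ^2 + a_3 ħ^3 + a_4 ħ^4 + a_5 ħ^5 + a_6 ħ^6 ) (i.e., with its formal power-series expansion truncated at order ħ^7), where a_1 = t_1/8, a_2 = t_1^2/16, a_3 = t_1^3/24 + 9 t_3/128, a_4 = t_1^4/32 + 27 t_3 t_1/128, a_5 = t_1^5/40 + 27 t_3 t_1^2/64 + 225 t_5/1024, and a_6 = t_1^6/48 + 45 t_3 t_1^3/64 + 1125 t_5 t_1/1024 + 567 t_3^2/1024. Equivalently, the first six ħ-coefficients of log τ_{BGW}, for τ_{BGW} = e^{ħ W_0}·1, are a_1, …, a_6. -/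
open MvPolynomial

/-- The coefficients `a_1, …, a_6` of `log τ_BGW`, in the encoding
`t_1 = X 0`, `t_3 = X 1`, `t_5 = X 2`. -/
noncomputable def aBGW : ℕ → PR
  | 1 => (1 / 8 : ℝ) • X 0
  | 2 => (1 / 16 : ℝ) • (X 0) ^ 2
  | 3 => (1 / 24 : ℝ) • (X 0) ^ 3 + (9 / 128 : ℝ) • X 1
  | 4 => (1 / 32 : ℝ) • (X 0) ^ 4 + (27 / 128 : ℝ) • (X 1 * X 0)
  | 5 => (1 / 40 : ℝ) • (X 0) ^ 5 + (27 / 64 : ℝ) • (X 1 * (X 0) ^ 2)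
          + (225 / 1024 : ℝ) • X 2
  | 6 => (1 / 48 : ℝ) • (X 0) ^ 6 + (45 / 64 : ℝ) • (X 1 * (X 0) ^ 3)
          + (1125 / 1024 : ℝ) • (X 2 * X 0) + (567 / 1024 : ℝ) • (X 1) ^ 2
  | _ => 0

theorem pderiv_ofNat {R σ : Type*} [CommSemiring R] (i : σ) (n : ℕ) [n.AtLeastTwo] :
    pderiv i (ofNat(n) : MvPolynomial σ R) = 0 :=
  (pderiv i).map_natCast n

/-- The recurrence for the coefficients of a truncated exponential, obtained by comparing
coefficients in `(exp S)' = S' * exp S`. -/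
theorem coeff_truncated_exp_succ {A : Type*} [CommRing A] [Algebra ℝ A] (S : Polynomial A)
    (hS : S.coeff 0 = 0) {N i : ℕ} (hi : i < N) :
    (∑ j ∈ Finset.range (N + 1), ((j.factorial : ℝ))⁻¹ • S ^ j).coeff (i + 1) =
      ((i + 1 : ℝ))⁻¹ • ∑ k ∈ Finset.range (i + 1), ((k + 1 : ℝ) • S.coeff (k + 1)) *
        (∑ j ∈ Finset.range (N + 1), ((j.factorial : ℝ))⁻¹ • S ^ j).coeff (i - k) := by
  set E := ∑ j ∈ Finset.range (N + 1), ((j.factorial : ℝ))⁻¹ • S ^ j with hE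
  have hderiv : E.derivative + S.derivative * ((N.factorial : ℝ)⁻¹ • S ^ N) =
      S.derivative * E := by
    have hsucc : E.derivative =
        S.derivative * ∑ j ∈ Finset.range N, (j.factorial : ℝ)⁻¹ • S ^ j := by
      rw [hE, Finset.sum_range_succ', Polynomial.derivative_add, Polynomial.derivative_sum,
        Finset.mul_sum]
      simp only [Polynomial.derivative_smul, pow_zero, Polynomial.derivative_one, smul_zero,
        add_zero, Polynomial.derivative_pow_succ]
      refine Finset.sum_congr rfl fun j _ ↦ ?_
      have hj : ((j + 1).factorial : ℝ)⁻¹ * (j + 1) = (j.factorial : ℝ)⁻¹ := by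
        rw [Nat.factorial_succ]
        push_cast
        field_simp
      have hcast : (Polynomial.C (j + 1 : A)) = algebraMap ℝ (Polynomial A) (j + 1) := by simp
      rw [hcast, ← hj]
      simp only [Algebra.smul_def, map_mul]
      ring
    rw [hsucc, ← mul_add, hE, Finset.sum_range_succ]
  have hvanish : (S.derivative * ((N.factorial : ℝ)⁻¹ • S ^ N)).coeff i = 0 := by
    have hdvd : Polynomial.X ^ N ∣ S.derivative * ((N.factorial : ℝ)⁻¹ • S ^ N) :=
      (dvd_smul_of_dvd _ (pow_dvd_pow_of_dvd (Polynomial.X_dvd_iff.2 hS) N)).mul_left _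
    exact Polynomial.X_pow_dvd_iff.1 hdvd i hi
  have hcoeff := congrArg (fun p : Polynomial A ↦ p.coeff i) hderiv
  simp only [Polynomial.coeff_add, hvanish, add_zero, Polynomial.coeff_derivative,
    Polynomial.coeff_mul, Finset.Nat.sum_antidiagonal_eq_sum_range_succ_mk] at hcoeff
  rw [eq_inv_smul_iff₀ (by positivity)]
  simpa [Algebra.smul_def, mul_comm] using hcoeff

theorem pderiv_pderiv_comm {R σ : Type*} [CommSemiring R] (a b : σ) (P : MvPolynomial σ R) :
    pderiv a (pderiv b P) = pderiv b (pderiv a P) := by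
  classical
  ext m
  simp only [coeff_pderiv, Finsupp.add_apply, add_right_comm m]
  by_cases h : a = b
  · rw [h]
  · simp [h, Ne.symm h]
    ring

/-- On a polynomial in the first `N` variables, the sums defining `W0` may be restricted to
indices below `N`. -/
theorem W0_eq_sum_range (N : ℕ) (P : PR) (hP : ∀ n, N ≤ n → pderiv n P = 0) :
    W0 P = (∑ a ∈ Finset.range N, ∑ b ∈ Finset.range N,
      ((((2 * a + 1) * (2 * b + 1) : ℕ) : ℝ) • (X a * X b * pderiv (a + b) P)
        + (((2 * a + 2 * b + 3 : ℕ) : ℝ) / 2) • (X (a + b + 1) * pderiv a (pderiv b P))))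
      + (1 / 8 : ℝ) • (X 0 * P) := by
  unfold W0
  congr 1
  have inner (a : ℕ) := finsum_eq_sum_of_support_subset (s := Finset.range N) (fun b : ℕ ↦
      (((2 * a + 1) * (2 * b + 1) : ℕ) : ℝ) • (X a * X b * pderiv (a + b) P)
        + (((2 * a + 2 * b + 3 : ℕ) : ℝ) / 2) • (X (a + b + 1) * pderiv a (pderiv b P))) (by
    refine Function.support_subset_iff'.2 fun b hb ↦ ?_
    have hb : N ≤ b := by simpa using hb
    simp [hP b hb, hP (a + b) (by omega)])
  simp_rw [inner]
  refine finsum_eq_sum_of_support_subset _ (Function.support_subset_iff'.2 fun a ha ↦ ?_)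
  have ha : N ≤ a := by simpa using ha
  refine Finset.sum_eq_zero fun b _ ↦ ?_
  simp [pderiv_pderiv_comm a b, hP a ha, hP (a + b) (by omega)]

theorem W0_iterate_one :
    W0^[1] (1 : PR) = (1 / 8 : ℝ) • X 0 := by
  rw [Function.iterate_succ_apply', Function.iterate_zero_apply, W0_eq_sum_range 1]
  · simp
  · intro n hn
    simp

theorem W0_iterate_two :
    W0^[2] (1 : PR) = (9 / 64 : ℝ) • X 0 ^ 2 := by
  rw [Function.iterate_succ_apply', W0_iterate_one, W0_eq_sum_range 1]
  · simp
    algebra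
  · intro n hn
    simp [pderiv_X_of_ne (show 0 ≠ n by omega)]

theorem W0_iterate_three :
    W0^[3] (1 : PR) = (153 / 512 : ℝ) • X 0 ^ 3 + (27 / 64 : ℝ) • X 1 := by
  rw [Function.iterate_succ_apply', W0_iterate_two, W0_eq_sum_range 1]
  · simp [pderiv_ofNat]
    algebra
  · intro n hn
    simp [pderiv_X_of_ne (show 0 ≠ n by omega)]

theorem W0_iterate_four :
    W0^[4] (1 : PR) = (3825 / 4096 : ℝ) • X 0 ^ 4 + (675 / 128 : ℝ) • (X 0 * X 1) := by
  rw [Function.iterate_succ_apply', W0_iterate_three, W0_eq_sum_range 2]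
  · simp [Finset.sum_range_succ, pderiv_X, Pi.single_apply, pderiv_ofNat]
    algebra
  · intro n hn
    simp [pderiv_X_of_ne (show 0 ≠ n by omega),
      pderiv_X_of_ne (show 1 ≠ n by omega)]

theorem W0_iterate_five :
    W0^[5] (1 : PR) = (126225 / 32768 : ℝ) • X 0 ^ 5 + (111375 / 2048 : ℝ) • (X 0 ^ 2 * X 1)
      + (3375 / 128 : ℝ) • X 2 := by
  rw [Function.iterate_succ_apply', W0_iterate_four, W0_eq_sum_range 2]
  · simp [Finset.sum_range_succ, pderiv_X, Pi.single_apply, pderiv_ofNat]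
    algebra
  · intro n hn
    simp [pderiv_X_of_ne (show 0 ≠ n by omega),
      pderiv_X_of_ne (show 1 ≠ n by omega)]

theorem W0_iterate_six :
    W0^[6] (1 : PR) = (5175225 / 262144 : ℝ) • X 0 ^ 6 + (4566375 / 8192 : ℝ) • (X 0 ^ 3 * X 1)
      + (415125 / 512 : ℝ) • (X 0 * X 2) + (820125 / 2048 : ℝ) • X 1 ^ 2 := by
  rw [Function.iterate_succ_apply', W0_iterate_five, W0_eq_sum_range 3]
  · simp [Finset.sum_range_succ, pderiv_X, Pi.single_apply, pderiv_ofNat]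
    algebra
  · intro n hn
    simp [pderiv_X_of_ne (show 0 ≠ n by omega),
      pderiv_X_of_ne (show 1 ≠ n by omega),
      pderiv_X_of_ne (show 2 ≠ n by omega)]

/-- With `c_n = (1/n!) W_0ⁿ · 1`, the truncated series `Σ_{n=0}^{6} c_n ħⁿ` agrees
modulo `ħ⁷` with the formal expansion of
`exp(a_1 ħ + a_2 ħ² + a_3 ħ³ + a_4 ħ⁴ + a_5 ħ⁵ + a_6 ħ⁶)`: the first six
`ħ`-coefficients of `log τ_BGW`, for `τ_BGW = e^{ħ W_0} · 1`, are `a_1, …, a_6`. -/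
theorem statement8 :
    ∀ i : ℕ, i < 7 →
      (∑ n ∈ Finset.range 7,
          Polynomial.C (((n.factorial : ℝ))⁻¹ • (W0^[n] (1 : PR)))
            * Polynomial.X ^ n).coeff i
      = (∑ j ∈ Finset.range 7,
          ((j.factorial : ℝ))⁻¹ •
            (∑ m ∈ Finset.Icc 1 6, Polynomial.C (aBGW m) * Polynomial.X ^ m) ^ j).coeff i := by
  intro i hi
  set S : Polynomial PR := ∑ m ∈ Finset.Icc 1 6, Polynomial.C (aBGW m) * Polynomial.X ^ m with hS
  have hSc (k : ℕ) : S.coeff k = if k ∈ Finset.Icc 1 6 then aBGW k else 0 := by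
    simp [hS, Polynomial.coeff_X_pow]
  have hS0 : S.coeff 0 = 0 := by simp [hSc]
  have hrec {i : ℕ} (hi : i < 6) := coeff_truncated_exp_succ S hS0 hi
  have hE0 : (∑ j ∈ Finset.range 7, ((j.factorial : ℝ))⁻¹ • S ^ j).coeff 0 = 1 := by
    simp [Finset.sum_range_succ, pow_succ, hS0]
  rw [Polynomial.finsetSum_coeff]
  simp only [Polynomial.coeff_C_mul_X_pow]
  generalize (∑ j ∈ Finset.range 7, ((j.factorial : ℝ))⁻¹ • S ^ j) = E at hrec hE0 ⊢
  clear_value S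
  have hE1 : E.coeff 1 = ((1).factorial : ℝ)⁻¹ • W0^[1] 1 := by
    rw [hrec (by norm_num), W0_iterate_one]
    simp [hSc, aBGW, hE0]
  have hE2 : E.coeff 2 = ((2).factorial : ℝ)⁻¹ • W0^[2] 1 := by
    rw [hrec (by norm_num), W0_iterate_two]
    simp [Finset.sum_range_succ, hSc, aBGW, Nat.factorial, hE0, hE1, W0_iterate_one,
      -Function.iterate_succ, -Function.iterate_one]
    algebra
  have hE3 : E.coeff 3 = ((3).factorial : ℝ)⁻¹ • W0^[3] 1 := by
    rw [hrec (by norm_num), W0_iterate_three]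
    simp [Finset.sum_range_succ, hSc, aBGW, Nat.factorial, hE0,
      hE1, W0_iterate_one, hE2, W0_iterate_two,
      -Function.iterate_succ, -Function.iterate_one]
    algebra
  have hE4 : E.coeff 4 = ((4).factorial : ℝ)⁻¹ • W0^[4] 1 := by
    rw [hrec (by norm_num), W0_iterate_four]
    simp [Finset.sum_range_succ, hSc, aBGW, Nat.factorial, hE0,
      hE1, W0_iterate_one, hE2, W0_iterate_two, hE3, W0_iterate_three,
      -Function.iterate_succ, -Function.iterate_one]
    algebra
  have hE5 : E.coeff 5 = ((5).factorial : ℝ)⁻¹ • W0^[5] 1 := by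
    rw [hrec (by norm_num), W0_iterate_five]
    simp [Finset.sum_range_succ, hSc, aBGW, Nat.factorial, hE0,
      hE1, W0_iterate_one, hE2, W0_iterate_two, hE3, W0_iterate_three, hE4, W0_iterate_four,
      -Function.iterate_succ, -Function.iterate_one]
    algebra
  have hE6 : E.coeff 6 = ((6).factorial : ℝ)⁻¹ • W0^[6] 1 := by
    rw [hrec (by norm_num), W0_iterate_six]
    simp [Finset.sum_range_succ, hSc, aBGW, Nat.factorial, hE0,
      hE1, W0_iterate_one, hE2, W0_iterate_two, hE3, W0_iterate_three, hE4, W0_iterate_four,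
      hE5, W0_iterate_five,
      -Function.iterate_succ, -Function.iterate_one]
    algebra
  interval_cases i <;> simp [hE0, hE1, hE2, hE3, hE4, hE5, hE6]
end
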